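/- arXiv:1612.01020 — 6 statements merged into one kernel-verified Lean document; each statement's English description precedes it below -/
import Mathlib

section
/- Let A be a learning algorithm mapping labeled samples to real-valued functions that satisfies the stability condition with coefficients c_i ≥ 0, let G: ℝ² → ℝ be L-Lipschitz, and let H_G: ℝ² → ℝ be L-Lipschitz in its first argument. Fix functions f^so, f̂^so, w_G: ℝ^d → ℝ and points (X_1, Y_1), …, (X_n, Y_n) ∈ ℝ^d × ℝ. Define ŵ = A({(X_i, H_G(f̂^so(X_i), Y_i))}_{i=1}^n), w̃ = A({(X_i, H_G(f^so(X_i), Y_i))}_{i=1}^n), f^ta(x) = G(f^so(x), w_G(x)), and f̂^ta(x) = G(f̂^so(x), ŵ(x)). Then for every x ∈ ℝ^d: |f̂^ta(x) − f^ta(x)|² ≤ L²·|f̂^so(x) − f^so(x)|² + 2L⁴·(Σ_{i=1}^n c_i |f̂^so(X_i) − f^so(X_i)|)² + 2L²·|w̃(x) − w_G(x)|². -/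
/-- Stability of a learning algorithm propagates the source-domain
estimation error through the transformation function `G` in the hypothesis transfer
learning framework (Theorem 1 of the paper, explicit-constant form).
Here `what = A ({(Xᵢ, H_G(fsoHat(Xᵢ), Yᵢ))})`, `wtil = A ({(Xᵢ, H_G(fso(Xᵢ), Yᵢ))})`,
`fta(x) = G(fso(x), wG(x))` and `ftaHat(x) = G(fsoHat(x), what(x))`. -/
theorem stability_transfer_risk_propagation
    {d n : ℕ}
    -- a learning algorithm mapping labeled samples to real-valued functions
    (A : (Fin n → EuclideanSpace ℝ (Fin d) × ℝ) → EuclideanSpace ℝ (Fin d) → ℝ)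
    -- stability coefficients
    (c : Fin n → ℝ) (hc : ∀ i, 0 ≤ c i)
    (X : Fin n → EuclideanSpace ℝ (Fin d)) (Y : Fin n → ℝ)
    -- the stability condition: for any two samples with the same inputs
    (hA : ∀ (W W' : Fin n → ℝ) (x : EuclideanSpace ℝ (Fin d)),
      |A (fun i => (X i, W i)) x - A (fun i => (X i, W' i)) x| ≤
        ∑ i, c i * |W i - W' i|)
    -- the transformation function `G` is `L`-Lipschitz
    (G : ℝ → ℝ → ℝ) (L : ℝ)
    (hG : ∀ a b a' b', |G a b - G a' b'| ≤ L * Real.sqrt ((a - a') ^ 2 + (b - b') ^ 2))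
    -- `H_G` is `L`-Lipschitz in its first argument
    (H : ℝ → ℝ → ℝ)
    (hH : ∀ x x' y, |H x y - H x' y| ≤ L * |x - x'|)
    (fso fsoHat wG : EuclideanSpace ℝ (Fin d) → ℝ)
    (x : EuclideanSpace ℝ (Fin d)) :
    |G (fsoHat x) (A (fun i => (X i, H (fsoHat (X i)) (Y i))) x)
        - G (fso x) (wG x)| ^ 2
      ≤ L ^ 2 * |fsoHat x - fso x| ^ 2
        + 2 * L ^ 4 * (∑ i, c i * |fsoHat (X i) - fso (X i)|) ^ 2
        + 2 * L ^ 2 * |A (fun i => (X i, H (fso (X i)) (Y i))) x - wG x| ^ 2 := by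
  have stab : |A (fun i => (X i, H (fsoHat (X i)) (Y i))) x
      - A (fun i => (X i, H (fso (X i)) (Y i))) x|
      ≤ L * ∑ i, c i * |fsoHat (X i) - fso (X i)| := by
    refine (hA _ _ x).trans ?_
    rw [Finset.mul_sum]
    refine Finset.sum_le_sum fun i _ => ?_
    calc c i * |H (fsoHat (X i)) (Y i) - H (fso (X i)) (Y i)|
        ≤ c i * (L * |fsoHat (X i) - fso (X i)|) :=
          mul_le_mul_of_nonneg_left (hH _ _ _) (hc i)
      _ = L * (c i * |fsoHat (X i) - fso (X i)|) := by ring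
  have lip := hG (fsoHat x) (A (fun i => (X i, H (fsoHat (X i)) (Y i))) x) (fso x) (wG x)
  generalize A (fun i => (X i, H (fsoHat (X i)) (Y i))) x = u at *
  generalize A (fun i => (X i, H (fso (X i)) (Y i))) x = v at *
  generalize ∑ i, c i * |fsoHat (X i) - fso (X i)| = S at *
  have stab_sq : (u - v) ^ 2 ≤ (L * S) ^ 2 := by
    rw [← sq_abs (u - v)]
    exact pow_le_pow_left₀ (abs_nonneg _) stab 2
  have split : (u - wG x) ^ 2 ≤ 2 * (L * S) ^ 2 + 2 * (v - wG x) ^ 2 := by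
    nlinarith [sq_nonneg ((u - v) - (v - wG x))]
  have lip_sq := pow_le_pow_left₀ (abs_nonneg _) lip 2
  rw [mul_pow, Real.sq_sqrt (by positivity)] at lip_sq
  refine lip_sq.trans ?_
  rw [sq_abs, sq_abs]
  calc L ^ 2 * ((fsoHat x - fso x) ^ 2 + (u - wG x) ^ 2)
      ≤ L ^ 2 * ((fsoHat x - fso x) ^ 2 + (2 * (L * S) ^ 2 + 2 * (v - wG x) ^ 2)) := by
        gcongr
    _ = _ := by ring
end

section
/- Let H be a real Hilbert space, let φ_1, …, φ_n, ψ ∈ H satisfy ‖φ_i‖² ≤ k for all i and ‖ψ‖² ≤ k, let λ > 0, let M ∈ ℝ^{n×n} be the Gram matrix with M_{ij} = ⟨φ_i, φ_j⟩, and let v ∈ ℝⁿ with v_i = ⟨φ_i, ψ⟩. Then the matrix M + nλI is invertible, and for any two label vectors u, ũ ∈ ℝⁿ: |(u − ũ)ᵀ (M + nλI)⁻¹ v| ≤ (k/(nλ)) · Σ_{i=1}^n |u_i − ũ_i|. (This is the change in the kernel ridge regression prediction at a test point when the training labels change from u to ũ, with kernel bounded by k and regularization parameter λ; hence kernel ridge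 regression satisfies the stability condition with coefficients c_i = k/(nλ).) -/
open scoped RealInnerProductSpace Matrix

/-- A solution `a` of the regularized normal equations has a residual `ψ - ∑ aⱼ φⱼ` no longer
than `ψ`. -/
theorem norm_residual_le_of_regularized {H ι : Type*} [NormedAddCommGroup H]
    [InnerProductSpace ℝ H] [Fintype ι] {c : ℝ} (hc : 0 ≤ c) (φ : ι → H) (ψ : H) (a : ι → ℝ)
    (ha : ∀ i, c * a i = ⟪φ i, ψ - ∑ j, a j • φ j⟫) :
    ‖ψ - ∑ j, a j • φ j‖ ≤ ‖ψ‖ := by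
  set w := ∑ j, a j • φ j with hw
  have hpos : 0 ≤ ⟪w, ψ - w⟫ := by
    have h : ⟪w, ψ - w⟫ = ∑ i, c * (a i * a i) := by
      conv_lhs => rw [hw, sum_inner]
      refine Finset.sum_congr rfl fun i _ => ?_
      rw [real_inner_smul_left, ← hw, ← ha i]
      ring
    rw [h]
    exact Finset.sum_nonneg fun i _ => mul_nonneg hc (mul_self_nonneg _)
  have hsq : ‖ψ - w‖ * ‖ψ - w‖ ≤ ‖ψ‖ * ‖ψ - w‖ := by
    have h : ⟪ψ - w, ψ - w⟫ = ⟪ψ, ψ - w⟫ - ⟪w, ψ - w⟫ := inner_sub_left _ _ _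
    rw [real_inner_self_eq_norm_mul_norm] at h
    linarith [real_inner_le_norm ψ (ψ - w)]
  by_contra! hlt
  nlinarith [norm_nonneg ψ]

/-- Stability of kernel ridge regression: with a kernel bounded by `k`
(feature vectors `φᵢ` and test feature `ψ` of squared norm at most `k`), Gram matrix
`M`, and regularization `λ > 0`, the matrix `M + nλI` is invertible and the change in
the KRR prediction at the test point when the labels change from `u` to `ũ` is at most
`(k/(nλ)) ∑ᵢ |uᵢ − ũᵢ|`. -/
theorem kernel_ridge_regression_stability
    {H : Type*} [NormedAddCommGroup H] [InnerProductSpace ℝ H]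
    {n : ℕ} (hn : 0 < n)
    (k lam : ℝ) (hlam : 0 < lam)
    (φ : Fin n → H) (ψ : H)
    (hφ : ∀ i, ‖φ i‖ ^ 2 ≤ k) (hψ : ‖ψ‖ ^ 2 ≤ k)
    (M : Matrix (Fin n) (Fin n) ℝ) (hM : ∀ i j, M i j = ⟪φ i, φ j⟫)
    (v : Fin n → ℝ) (hv : ∀ i, v i = ⟪φ i, ψ⟫) :
    IsUnit (M + ((n : ℝ) * lam) • (1 : Matrix (Fin n) (Fin n) ℝ)) ∧
    ∀ u utid : Fin n → ℝ,
      |(u - utid) ⬝ᵥ (M + ((n : ℝ) * lam) • (1 : Matrix (Fin n) (Fin n) ℝ))⁻¹.mulVec v|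
        ≤ k / ((n : ℝ) * lam) * ∑ i, |u i - utid i| := by
  have hc : 0 < (n : ℝ) * lam := by positivity
  set c := (n : ℝ) * lam
  have hgram : M = Matrix.gram ℝ φ := by
    ext i j
    exact hM i j
  have hunit : IsUnit (M + c • (1 : Matrix (Fin n) (Fin n) ℝ)) := by
    rw [hgram]
    exact (Matrix.PosDef.posSemidef_add (Matrix.posSemidef_gram ℝ φ)
      (Matrix.PosDef.one.smul hc)).isUnit
  refine ⟨hunit, fun u utid => ?_⟩
  set a := (M + c • (1 : Matrix (Fin n) (Fin n) ℝ))⁻¹.mulVec v with ha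
  have hsolve : (M + c • (1 : Matrix (Fin n) (Fin n) ℝ)).mulVec a = v := by
    rw [ha, Matrix.mulVec_mulVec,
      Matrix.mul_nonsing_inv _ ((Matrix.isUnit_iff_isUnit_det _).1 hunit), Matrix.one_mulVec]
  have hres : ∀ i, c * a i = ⟪φ i, ψ - ∑ j, a j • φ j⟫ := by
    intro i
    have h := congrFun hsolve i
    rw [Matrix.add_mulVec, Matrix.smul_mulVec, Matrix.one_mulVec, hv] at h
    simp only [Pi.add_apply, Pi.smul_apply, smul_eq_mul, Matrix.mulVec, dotProduct, hM] at h
    rw [inner_sub_right, inner_sum, ← h]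
    simp only [real_inner_smul_right, mul_comm]
    ring
  have hbound : ∀ i, |a i| ≤ k / c := by
    intro i
    rw [le_div_iff₀ hc]
    calc |a i| * c = |⟪φ i, ψ - ∑ j, a j • φ j⟫| := by
          rw [← hres i, abs_mul, abs_of_pos hc, mul_comm]
      _ ≤ ‖φ i‖ * ‖ψ - ∑ j, a j • φ j‖ := abs_real_inner_le_norm _ _
      _ ≤ ‖φ i‖ * ‖ψ‖ := by
          gcongr
          exact norm_residual_le_of_regularized hc.le φ ψ a hres
      _ ≤ k := by nlinarith [hφ i, sq_nonneg (‖φ i‖ - ‖ψ‖)]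
  calc |(u - utid) ⬝ᵥ a| ≤ ∑ i, |(u - utid) i * a i| := Finset.abs_sum_le_sum_abs _ _
    _ ≤ ∑ i, k / c * |u i - utid i| := by
        refine Finset.sum_le_sum fun i _ => ?_
        rw [abs_mul, mul_comm, Pi.sub_apply]
        exact mul_le_mul_of_nonneg_right (hbound i) (abs_nonneg _)
    _ = k / c * ∑ i, |u i - utid i| := (Finset.mul_sum _ _ _).symm
end

section
/- Let A be the kernel smoothing algorithm (so that A satisfies the stability condition with coefficients c_i(x) = w_i(x) summing to one at every evaluation point), let G: ℝ² → ℝ be L-Lipschitz, and let H_G: ℝ² → ℝ be L-Lipschitz in its first argument. With f^so, f̂^so, w_G, points (X_i, Y_i), and the estimators ŵ, w̃, f^ta(x) = G(f^so(x), w_G(x)), f̂^ta(x) = G(f̂^so(x), ŵ(x)) constructed as in the transfer framework, for every x at which the kernel smoothing weights are well-defined: |f̂^ta(x) − f^ta(x)|² ≤ L²·|f̂^so(x) − f^so(x)|² + 2L⁴·max_{1≤i≤n}|f̂^so(X_i) − f^so(X_i)|² + 2L²·|w̃(x) − w_G(x)|². -/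
open Finset

/-- A weighted average with nonnegative weights of total mass one is stable: it moves by at most
the largest change of its arguments. -/
theorem abs_sum_mul_sub_sum_mul_le {ι : Type*} {s : Finset ι} {c u v : ι → ℝ} {B : ℝ}
    (hc : ∀ i ∈ s, 0 ≤ c i) (hsum : ∑ i ∈ s, c i = 1) (huv : ∀ i ∈ s, |u i - v i| ≤ B) :
    |∑ i ∈ s, c i * u i - ∑ i ∈ s, c i * v i| ≤ B :=
  calc |∑ i ∈ s, c i * u i - ∑ i ∈ s, c i * v i|
      = |∑ i ∈ s, c i * (u i - v i)| := by simp only [mul_sub, Finset.sum_sub_distrib]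
    _ ≤ ∑ i ∈ s, |c i * (u i - v i)| := Finset.abs_sum_le_sum_abs _ _
    _ ≤ ∑ i ∈ s, c i * B := by
        refine Finset.sum_le_sum fun i hi => ?_
        rw [abs_mul, abs_of_nonneg (hc i hi)]
        exact mul_le_mul_of_nonneg_left (huv i hi) (hc i hi)
    _ = B := by rw [← Finset.sum_mul, hsum, one_mul]

/-- The transfer-framework error bound instantiated with the kernel
smoothing algorithm: the kernel smoothing weights sum to one, so the stability term is
bounded by the maximal source-domain estimation error over the sample points. -/
theorem kernel_smoothing_transfer_bound
    {d n : ℕ} (hn : 0 < n)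
    (K : ℝ → ℝ) (hK : ∀ t, 0 ≤ t → 0 ≤ K t)
    (X : Fin n → EuclideanSpace ℝ (Fin d)) (Y : Fin n → ℝ) (h : ℝ) (hh : 0 < h)
    -- the transformation function `G` is `L`-Lipschitz
    (G : ℝ → ℝ → ℝ) (L : ℝ)
    (hG : ∀ a b a' b', |G a b - G a' b'| ≤ L * Real.sqrt ((a - a') ^ 2 + (b - b') ^ 2))
    -- `H_G` is `L`-Lipschitz in its first argument
    (H : ℝ → ℝ → ℝ)
    (hH : ∀ x x' y, |H x y - H x' y| ≤ L * |x - x'|)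
    (fso fsoHat wG : EuclideanSpace ℝ (Fin d) → ℝ)
    -- a point at which the kernel smoothing weights are well-defined
    (x : EuclideanSpace ℝ (Fin d))
    (hden : 0 < ∑ j, K (‖x - X j‖ / h)) :
    -- with `A` the kernel smoothing algorithm,
    -- `what = A {(Xᵢ, H(fsoHat Xᵢ, Yᵢ))}` and `wtil = A {(Xᵢ, H(fso Xᵢ, Yᵢ))}`:
    |G (fsoHat x)
        (∑ i, K (‖x - X i‖ / h) / (∑ j, K (‖x - X j‖ / h)) * H (fsoHat (X i)) (Y i))
      - G (fso x) (wG x)| ^ 2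
      ≤ L ^ 2 * |fsoHat x - fso x| ^ 2
        + 2 * L ^ 4 *
            Finset.univ.sup' (Finset.univ_nonempty_iff.mpr ⟨⟨0, hn⟩⟩)
              (fun i => |fsoHat (X i) - fso (X i)| ^ 2)
        + 2 * L ^ 2 *
            |(∑ i, K (‖x - X i‖ / h) / (∑ j, K (‖x - X j‖ / h)) * H (fso (X i)) (Y i))
              - wG x| ^ 2 := by
  have hL : 0 ≤ L := by simpa using (abs_nonneg _).trans (hH 1 0 0)
  set M := Finset.univ.sup' (Finset.univ_nonempty_iff.mpr ⟨⟨0, hn⟩⟩)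
    (fun i => |fsoHat (X i) - fso (X i)| ^ 2) with hM
  have hle (i : Fin n) : |fsoHat (X i) - fso (X i)| ^ 2 ≤ M :=
    Finset.le_sup' (fun i => |fsoHat (X i) - fso (X i)| ^ 2) (Finset.mem_univ i)
  have hM0 : 0 ≤ M := (sq_nonneg _).trans (hle ⟨0, hn⟩)
  have hstab : |(∑ i, K (‖x - X i‖ / h) / (∑ j, K (‖x - X j‖ / h)) * H (fsoHat (X i)) (Y i))
      - ∑ i, K (‖x - X i‖ / h) / (∑ j, K (‖x - X j‖ / h)) * H (fso (X i)) (Y i)|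
      ≤ L * √M := by
    refine abs_sum_mul_sub_sum_mul_le (fun i _ => ?_) ?_ fun i _ => ?_
    · exact div_nonneg (hK _ (by positivity)) hden.le
    · rw [← Finset.sum_div, div_self hden.ne']
    · exact (hH _ _ _).trans (mul_le_mul_of_nonneg_left (Real.le_sqrt_of_sq_le (hle i)) hL)
  generalize (∑ i, K (‖x - X i‖ / h) / (∑ j, K (‖x - X j‖ / h)) * H (fsoHat (X i)) (Y i)) = p
    at hstab ⊢
  generalize (∑ i, K (‖x - X i‖ / h) / (∑ j, K (‖x - X j‖ / h)) * H (fso (X i)) (Y i)) = q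
    at hstab ⊢
  have hpq : (p - q) ^ 2 ≤ L ^ 2 * M := by
    rw [← sq_abs, ← Real.sq_sqrt hM0, ← mul_pow]
    exact pow_le_pow_left₀ (abs_nonneg _) hstab 2
  have hp : (p - wG x) ^ 2 ≤ 2 * (L ^ 2 * M) + 2 * (q - wG x) ^ 2 := by
    linarith [sq_nonneg ((p - q) - (q - wG x))]
  have hGsq := pow_le_pow_left₀ (abs_nonneg _) (hG (fsoHat x) p (fso x) (wG x)) 2
  rw [mul_pow, Real.sq_sqrt (by positivity)] at hGsq
  simp only [sq_abs] at hGsq ⊢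
  linarith [mul_le_mul_of_nonneg_left hp (sq_nonneg L)]
end

section
/- Let A be a learning algorithm satisfying the stability condition with coefficients c_i ≤ k/(nλ) for all i = 1, …, n (as holds for kernel ridge regression with kernel bounded by k and regularization parameter λ > 0), let G: ℝ² → ℝ be L-Lipschitz, and let H_G: ℝ² → ℝ be L-Lipschitz in its first argument. With f^so, f̂^so, w_G, points (X_i, Y_i), and the estimators ŵ, w̃, f^ta(x) = G(f^so(x), w_G(x)), f̂^ta(x) = G(f̂^so(x), ŵ(x)) constructed as in the transfer framework, for every x ∈ ℝ^d: |f̂^ta(x) − f^ta(x)|² ≤ L²·|f̂^so(x) − f^so(x)|² + 2L⁴·(k/λ)²·max_{1≤i≤n}|f̂^so(X_i) − f^so(X_i)|² + 2L²·|w̃(x) − w_G(x)|². -/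
open Finset

/-- The transfer-framework error bound for an algorithm whose stability
coefficients are bounded by `k/(nλ)` (as for kernel ridge regression with kernel bounded
by `k` and regularization `λ`): the stability term is bounded by
`(k/λ)²` times the maximal source-domain estimation error over the sample. -/
theorem krr_stability_transfer_bound
    {d n : ℕ} (hn : 0 < n)
    (A : (Fin n → EuclideanSpace ℝ (Fin d) × ℝ) → EuclideanSpace ℝ (Fin d) → ℝ)
    (c : Fin n → ℝ) (hc : ∀ i, 0 ≤ c i)
    (k lam : ℝ) (hlam : 0 < lam)
    (hck : ∀ i, c i ≤ k / ((n : ℝ) * lam))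
    (X : Fin n → EuclideanSpace ℝ (Fin d)) (Y : Fin n → ℝ)
    -- the stability condition: for any two samples with the same inputs
    (hA : ∀ (W W' : Fin n → ℝ) (x : EuclideanSpace ℝ (Fin d)),
      |A (fun i => (X i, W i)) x - A (fun i => (X i, W' i)) x| ≤
        ∑ i, c i * |W i - W' i|)
    -- the transformation function `G` is `L`-Lipschitz
    (G : ℝ → ℝ → ℝ) (L : ℝ)
    (hG : ∀ a b a' b', |G a b - G a' b'| ≤ L * Real.sqrt ((a - a') ^ 2 + (b - b') ^ 2))
    -- `H_G` is `L`-Lipschitz in its first argument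
    (H : ℝ → ℝ → ℝ)
    (hH : ∀ x x' y, |H x y - H x' y| ≤ L * |x - x'|)
    (fso fsoHat wG : EuclideanSpace ℝ (Fin d) → ℝ)
    (x : EuclideanSpace ℝ (Fin d)) :
    |G (fsoHat x) (A (fun i => (X i, H (fsoHat (X i)) (Y i))) x)
        - G (fso x) (wG x)| ^ 2
      ≤ L ^ 2 * |fsoHat x - fso x| ^ 2
        + 2 * L ^ 4 * (k / lam) ^ 2 *
            Finset.univ.sup' (Finset.univ_nonempty_iff.mpr ⟨⟨0, hn⟩⟩)
              (fun i => |fsoHat (X i) - fso (X i)| ^ 2)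
        + 2 * L ^ 2 * |A (fun i => (X i, H (fso (X i)) (Y i))) x - wG x| ^ 2 := by
  have hL : 0 ≤ L := by
    have h := (abs_nonneg _).trans (hH 1 0 0)
    simpa using h
  have hn' : (0 : ℝ) < n := by exact_mod_cast hn
  set M := Finset.univ.sup' (Finset.univ_nonempty_iff.mpr ⟨⟨0, hn⟩⟩)
    (fun i => |fsoHat (X i) - fso (X i)| ^ 2)
  have hle : ∀ i, |fsoHat (X i) - fso (X i)| ^ 2 ≤ M := fun i =>
    Finset.le_sup' (fun i => |fsoHat (X i) - fso (X i)| ^ 2) (Finset.mem_univ i)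
  have hM0 : 0 ≤ M := (sq_nonneg _).trans (hle ⟨0, hn⟩)
  set what := A (fun i => (X i, H (fsoHat (X i)) (Y i))) x
  set wtil := A (fun i => (X i, H (fso (X i)) (Y i))) x
  have hstab : |what - wtil| ≤ k / lam * (L * √M) := by
    calc |what - wtil|
        ≤ ∑ i, c i * |H (fsoHat (X i)) (Y i) - H (fso (X i)) (Y i)| := hA _ _ x
      _ ≤ ∑ _i : Fin n, k / (n * lam) * (L * √M) := by
          refine Finset.sum_le_sum fun i _ => ?_
          refine mul_le_mul (hck i) ((hH _ _ _).trans ?_) (abs_nonneg _)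
            ((hc i).trans (hck i))
          exact mul_le_mul_of_nonneg_left (Real.le_sqrt_of_sq_le (hle i)) hL
      _ = k / lam * (L * √M) := by
          rw [Finset.sum_const, Finset.card_univ, Fintype.card_fin, nsmul_eq_mul]
          field_simp
  have hstab_sq : (what - wtil) ^ 2 ≤ L ^ 2 * (k / lam) ^ 2 * M := by
    calc (what - wtil) ^ 2 = |what - wtil| ^ 2 := (sq_abs _).symm
      _ ≤ (k / lam * (L * √M)) ^ 2 := pow_le_pow_left₀ (abs_nonneg _) hstab 2
      _ = L ^ 2 * (k / lam) ^ 2 * M := by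
          rw [mul_pow, mul_pow, Real.sq_sqrt hM0]
          ring
  have hG_sq : |G (fsoHat x) what - G (fso x) (wG x)| ^ 2
      ≤ L ^ 2 * ((fsoHat x - fso x) ^ 2 + (what - wG x) ^ 2) := by
    refine (pow_le_pow_left₀ (abs_nonneg _) (hG _ _ _ _) 2).trans_eq ?_
    rw [mul_pow, Real.sq_sqrt (by positivity)]
  have hsplit : (what - wG x) ^ 2
      ≤ 2 * (L ^ 2 * (k / lam) ^ 2 * M) + 2 * (wtil - wG x) ^ 2 := by
    nlinarith [sq_nonneg ((what - wtil) - (wtil - wG x))]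
  rw [sq_abs (fsoHat x - fso x), sq_abs (wtil - wG x)]
  calc |G (fsoHat x) what - G (fso x) (wG x)| ^ 2
      ≤ L ^ 2 * ((fsoHat x - fso x) ^ 2 + (what - wG x) ^ 2) := hG_sq
    _ ≤ L ^ 2 * ((fsoHat x - fso x) ^ 2
          + (2 * (L ^ 2 * (k / lam) ^ 2 * M) + 2 * (wtil - wG x) ^ 2)) := by gcongr
    _ = _ := by ring
end

section
/- Let (X, Y) be a random pair with regression function f, meaning E[Y | X] = f(X) almost surely, and let g be measurable. Assume |Y| ≤ Δ, |f(X)| ≤ Δ, and |g(X)| ≤ Δ almost surely. Define U = (Y − f(X))² − (Y − g(X))². Then Var[U] ≤ E[U²] ≤ 20 Δ² · E[(g(X) − f(X))²] = 20 Δ² · (E[(Y − g(X))²] − E[(Y − f(X))²]); that is, the variance of U is bounded by a constant multiple of Δ² times the excess risk of g. -/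
open MeasureTheory ProbabilityTheory

/-- The residual of `Y` after subtracting its regression function on `X` is orthogonal to every
measurable function of `X`. -/
lemma integral_mul_comp_eq_of_condExp_comap_eq
    {Ω α : Type*} [MeasurableSpace Ω] [MeasurableSpace α]
    {P : Measure Ω} [IsFiniteMeasure P] {X : Ω → α} {Y : Ω → ℝ} {f h : α → ℝ}
    (hX : Measurable X) (hh : Measurable h) (hY : Integrable Y P)
    (hYh : Integrable (fun ω => Y ω * h (X ω)) P)
    (hreg : P[Y | MeasurableSpace.comap X inferInstance] =ᵐ[P] fun ω => f (X ω)) :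
    ∫ ω, Y ω * h (X ω) ∂P = ∫ ω, f (X ω) * h (X ω) ∂P := by
  have hmeas : StronglyMeasurable[MeasurableSpace.comap X inferInstance] (fun ω => h (X ω)) :=
    (hh.comp (comap_measurable X)).stronglyMeasurable
  rw [← integral_condExp hX.comap_le]
  refine integral_congr_ae ?_
  filter_upwards [condExp_mul_of_stronglyMeasurable_right hmeas hYh hY, hreg] with ω h₁ h₂
  exact h₁.trans (by rw [Pi.mul_apply, h₂])

/-- The excess risk of `g` over the regression function `f` is the squared `L²` distance. -/
lemma integral_sq_sub_regression_eq
    {Ω α : Type*} [MeasurableSpace Ω] [MeasurableSpace α]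
    {P : Measure Ω} [IsFiniteMeasure P] {X : Ω → α} {Y : Ω → ℝ} {f g : α → ℝ}
    (hX : Measurable X) (hf : Measurable f) (hg : Measurable g)
    (hY : MemLp Y 2 P) (hfX : MemLp (fun ω => f (X ω)) 2 P) (hgX : MemLp (fun ω => g (X ω)) 2 P)
    (hreg : P[Y | MeasurableSpace.comap X inferInstance] =ᵐ[P] fun ω => f (X ω)) :
    ∫ ω, (g (X ω) - f (X ω)) ^ 2 ∂P
      = ∫ ω, (Y ω - g (X ω)) ^ 2 ∂P - ∫ ω, (Y ω - f (X ω)) ^ 2 ∂P := by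
  have hfg : MemLp (fun ω => f (X ω) - g (X ω)) 2 P := hfX.sub hgX
  have hYfg : Integrable (fun ω => Y ω * (f (X ω) - g (X ω))) P := hY.integrable_mul hfg
  have hffg : Integrable (fun ω => f (X ω) * (f (X ω) - g (X ω))) P := hfX.integrable_mul hfg
  have horth := integral_mul_comp_eq_of_condExp_comap_eq (h := fun x => f x - g x) hX
    (hf.sub hg) (hY.integrable one_le_two) hYfg hreg
  have hdist : Integrable (fun ω => (g (X ω) - f (X ω)) ^ 2) P := (hgX.sub hfX).integrable_sq
  have hdiff : Integrable
      (fun ω => Y ω * (f (X ω) - g (X ω)) - f (X ω) * (f (X ω) - g (X ω))) P := hYfg.sub hffg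
  have hYg : Integrable (fun ω => (Y ω - g (X ω)) ^ 2) P := (hY.sub hgX).integrable_sq
  have hYf : Integrable (fun ω => (Y ω - f (X ω)) ^ 2) P := (hY.sub hfX).integrable_sq
  rw [← integral_sub hYg hYf]
  calc ∫ ω, (g (X ω) - f (X ω)) ^ 2 ∂P
      = ∫ ω, (g (X ω) - f (X ω)) ^ 2 ∂P + 2 *
          ∫ ω, (Y ω * (f (X ω) - g (X ω)) - f (X ω) * (f (X ω) - g (X ω))) ∂P := by
        rw [integral_sub hYfg hffg, horth]
        ring
    _ = ∫ ω, ((g (X ω) - f (X ω)) ^ 2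
          + 2 * (Y ω * (f (X ω) - g (X ω)) - f (X ω) * (f (X ω) - g (X ω)))) ∂P := by
        rw [integral_add hdist (hdiff.const_mul 2), integral_const_mul]
    _ = ∫ ω, ((Y ω - g (X ω)) ^ 2 - (Y ω - f (X ω)) ^ 2) ∂P := by
        congr 1 with ω
        ring

lemma sq_sub_sq_sq_le_of_abs_le {y a b Δ : ℝ} (hy : |y| ≤ Δ) (ha : |a| ≤ Δ) (hb : |b| ≤ Δ) :
    ((y - a) ^ 2 - (y - b) ^ 2) ^ 2 ≤ 16 * Δ ^ 2 * (b - a) ^ 2 := by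
  rw [abs_le] at hy ha hb
  have h : (2 * y - a - b) ^ 2 ≤ (4 * Δ) ^ 2 := sq_le_sq' (by linarith) (by linarith)
  calc ((y - a) ^ 2 - (y - b) ^ 2) ^ 2 = (2 * y - a - b) ^ 2 * (b - a) ^ 2 := by ring
    _ ≤ (4 * Δ) ^ 2 * (b - a) ^ 2 := by gcongr
    _ = 16 * Δ ^ 2 * (b - a) ^ 2 := by ring

/-- Variance bound for the risk difference: under boundedness by `Δ`,
with `U = (Y − f(X))² − (Y − g(X))²` one has
`Var[U] ≤ E[U²] ≤ 20 Δ² E[(g(X) − f(X))²]`, and the latter expectation equals the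
excess risk `R(g) − R(f)`. -/
theorem variance_risk_difference_bound
    {Ω α : Type*} [MeasurableSpace Ω] [MeasurableSpace α]
    (P : Measure Ω) [IsProbabilityMeasure P]
    (X : Ω → α) (Y : Ω → ℝ) (hX : Measurable X) (hY : Measurable Y)
    (f g : α → ℝ) (hf : Measurable f) (hg : Measurable g)
    (Δ : ℝ)
    (hbound : ∀ᵐ ω ∂P, |Y ω| ≤ Δ ∧ |f (X ω)| ≤ Δ ∧ |g (X ω)| ≤ Δ)
    -- `f` is the regression function: `E[Y | X] = f(X)` almost surely
    (hreg : P[Y | MeasurableSpace.comap X inferInstance] =ᵐ[P] fun ω => f (X ω)) :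
    variance (fun ω => (Y ω - f (X ω)) ^ 2 - (Y ω - g (X ω)) ^ 2) P
        ≤ ∫ ω, ((Y ω - f (X ω)) ^ 2 - (Y ω - g (X ω)) ^ 2) ^ 2 ∂P ∧
    (∫ ω, ((Y ω - f (X ω)) ^ 2 - (Y ω - g (X ω)) ^ 2) ^ 2 ∂P
        ≤ 20 * Δ ^ 2 * ∫ ω, (g (X ω) - f (X ω)) ^ 2 ∂P) ∧
    (20 * Δ ^ 2 * ∫ ω, (g (X ω) - f (X ω)) ^ 2 ∂P
        = 20 * Δ ^ 2 *
            (∫ ω, (Y ω - g (X ω)) ^ 2 ∂P - ∫ ω, (Y ω - f (X ω)) ^ 2 ∂P)) := by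
  have hfXm : Measurable fun ω => f (X ω) := hf.comp hX
  have hgXm : Measurable fun ω => g (X ω) := hg.comp hX
  have hYL : MemLp Y 2 P := .of_bound hY.aestronglyMeasurable Δ (hbound.mono fun _ h => h.1)
  have hfL : MemLp (fun ω => f (X ω)) 2 P :=
    .of_bound hfXm.aestronglyMeasurable Δ (hbound.mono fun _ h => h.2.1)
  have hgL : MemLp (fun ω => g (X ω)) 2 P :=
    .of_bound hgXm.aestronglyMeasurable Δ (hbound.mono fun _ h => h.2.2)
  refine ⟨variance_le_expectation_sq (by fun_prop), ?_, ?_⟩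
  · have hdist : Integrable (fun ω => (g (X ω) - f (X ω)) ^ 2) P := (hgL.sub hfL).integrable_sq
    rw [← integral_const_mul]
    refine integral_mono_of_nonneg (.of_forall fun ω => sq_nonneg _) (hdist.const_mul _) ?_
    filter_upwards [hbound] with ω ⟨hy, ha, hb⟩
    refine (sq_sub_sq_sq_le_of_abs_le hy ha hb).trans ?_
    gcongr
    norm_num
  · rw [integral_sq_sub_regression_eq hX hf hg hYL hfL hgL hreg]
end

section
/- Let A be a learning algorithm satisfying the stability condition with coefficients c_i ≥ 0, let G₁, G₂: ℝ² → ℝ be transformation functions such that G₂ is L-Lipschitz and sup_{a,b} |G₁(a,b) − G₂(a,b)| ≤ ε. Fix a function f̂^so: ℝ^d → ℝ, inputs X_1, …, X_n ∈ ℝ^d, and two label vectors W⁽¹⁾, W⁽²⁾ ∈ ℝⁿ with |W_i⁽¹⁾ − W_i⁽²⁾| ≤ L·ε for all i (as holds when the auxiliary functions satisfy ‖w_{G₁} − w_{G₂}‖_∞ ≤ L·ε and the labels differ by w_{G₁}(X_i) − w_{G₂}(X_i)). Set ŵ_j = A({(X_i, W_i⁽ʲ⁾)}_{i=1}^n) for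 j = 1, 2. Then for every x ∈ ℝ^d: |G₁(f̂^so(x), ŵ₁(x)) − G₂(f̂^so(x), ŵ₂(x))| ≤ ε · (1 + L² · Σ_{i=1}^n c_i); that is, the transfer estimators built from two transformation functions at sup-distance ε differ pointwise by at most ε(1 + L² Σ_i c_i). -/
/-- Transfer estimators built from two transformation functions at
sup-distance `ε` differ pointwise by at most `ε (1 + L² ∑ᵢ cᵢ)`: if the algorithm `A`
is stable with coefficients `cᵢ`, `G₂` is `L`-Lipschitz, `‖G₁ − G₂‖_∞ ≤ ε`, and the two
label vectors differ by at most `L·ε` coordinatewise, then for every `x` the two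
resulting transfer estimators are within `ε (1 + L² ∑ᵢ cᵢ)` of each other. -/
theorem transformation_cover_estimator_bound
    {d n : ℕ}
    (A : (Fin n → EuclideanSpace ℝ (Fin d) × ℝ) → EuclideanSpace ℝ (Fin d) → ℝ)
    (c : Fin n → ℝ) (hc : ∀ i, 0 ≤ c i)
    (X : Fin n → EuclideanSpace ℝ (Fin d))
    -- the stability condition: for any two samples with the same inputs
    (hA : ∀ (W W' : Fin n → ℝ) (x : EuclideanSpace ℝ (Fin d)),
      |A (fun i => (X i, W i)) x - A (fun i => (X i, W' i)) x| ≤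
        ∑ i, c i * |W i - W' i|)
    (G₁ G₂ : ℝ → ℝ → ℝ) (L ε : ℝ)
    -- `G₂` is `L`-Lipschitz
    (hG₂ : ∀ a b a' b', |G₂ a b - G₂ a' b'| ≤ L * Real.sqrt ((a - a') ^ 2 + (b - b') ^ 2))
    -- `G₁` and `G₂` are at sup-distance at most `ε`
    (hGG : ∀ a b, |G₁ a b - G₂ a b| ≤ ε)
    (fsoHat : EuclideanSpace ℝ (Fin d) → ℝ)
    (W₁ W₂ : Fin n → ℝ) (hW : ∀ i, |W₁ i - W₂ i| ≤ L * ε)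
    (x : EuclideanSpace ℝ (Fin d)) :
    |G₁ (fsoHat x) (A (fun i => (X i, W₁ i)) x)
      - G₂ (fsoHat x) (A (fun i => (X i, W₂ i)) x)|
      ≤ ε * (1 + L ^ 2 * ∑ i, c i) := by
  have hL : 0 ≤ L := by
    simpa using (abs_nonneg _).trans (hG₂ 1 0 0 0)
  set u := A (fun i => (X i, W₁ i)) x
  set v := A (fun i => (X i, W₂ i)) x
  have huv : |u - v| ≤ L * ε * ∑ i, c i :=
    calc |u - v| ≤ ∑ i, c i * |W₁ i - W₂ i| := hA W₁ W₂ x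
      _ ≤ ∑ i, c i * (L * ε) :=
        Finset.sum_le_sum fun i _ => mul_le_mul_of_nonneg_left (hW i) (hc i)
      _ = L * ε * ∑ i, c i := by rw [← Finset.sum_mul, mul_comm]
  have hLip : |G₂ (fsoHat x) u - G₂ (fsoHat x) v| ≤ L * |u - v| := by
    simpa [Real.sqrt_sq_eq_abs] using hG₂ (fsoHat x) u (fsoHat x) v
  calc |G₁ (fsoHat x) u - G₂ (fsoHat x) v|
      ≤ |G₁ (fsoHat x) u - G₂ (fsoHat x) u| + |G₂ (fsoHat x) u - G₂ (fsoHat x) v| :=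
        abs_sub_le _ _ _
    _ ≤ ε + L * (L * ε * ∑ i, c i) :=
        add_le_add (hGG _ _) (hLip.trans (mul_le_mul_of_nonneg_left huv hL))
    _ = ε * (1 + L ^ 2 * ∑ i, c i) := by ring
end
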